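/- arXiv:2207.13448 — 2 statements merged into one kernel-verified Lean document; each statement's English description precedes it below -/
import Mathlib

section
/- Let n be a positive integer, and for p ∈ [0,1] let μ_p be the product Bernoulli measure on {false, true}^n under which the coordinates are independent and each equals true with probability p. Let A ⊆ ({false, true}^n) be an increasing event, i.e. if ω ∈ A and ω ≤ ω' coordinatewise (with false ≤ true) then ω' ∈ A. For each coordinate i, define the influence Infl_i^p(A) as the μ_p-probability of the set of configurations ω such that exactly one of the two configurations obtained from ω by setting coordinate i to true, respectively to false, belongs to A. Then for every p ∈ (0,1), the function p ↦ μ_p(A) is differentiable at p with derivative equal to Σ_{i=1}^n Infl_i^p(A) (Russo–Margulis formula). -/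
open MeasureTheory

/-- The product Bernoulli mass of a configuration, restricted to the coordinates in `s`. -/
noncomputable def bernoulliWeight {ι : Type*} (s : Finset ι) (p : ℝ) (b : ι → Bool) : ℝ :=
  ∏ i ∈ s, if b i then p else 1 - p

open Classical in
/-- On a finite space, the real measure of a set is the sum of the masses of its points. -/
theorem toReal_measure_eq_sum_ite {α : Type*} [Fintype α] [MeasurableSpace α]
    [MeasurableSingletonClass α] (ν : Measure α) [IsFiniteMeasure ν] (S : Set α) :
    (ν S).toReal = ∑ b, if b ∈ S then (ν {b}).toReal else 0 := by
  have h : ν S = ∑ b ∈ Finset.univ.filter (· ∈ S), ν {b} := by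
    rw [sum_measure_singleton]
    congr 1
    ext
    simp
  rw [h, ENNReal.toReal_sum fun b _ => measure_ne_top ν {b}, Finset.sum_filter]

theorem hasDerivAt_bernoulliWeight {ι : Type*} [DecidableEq ι] (s : Finset ι) (p : ℝ)
    (b : ι → Bool) :
    HasDerivAt (fun q => bernoulliWeight s q b)
      (∑ i ∈ s, bernoulliWeight (s.erase i) p b * if b i then 1 else -1) p := by
  unfold bernoulliWeight
  refine HasDerivAt.fun_finsetProd fun i _ => ?_
  cases b i
  · simpa using (hasDerivAt_id p).const_sub 1
  · simpa using hasDerivAt_id' p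

theorem bernoulliWeight_erase_update {ι : Type*} [DecidableEq ι] (s : Finset ι) (p : ℝ)
    (b : ι → Bool) (i : ι) (c : Bool) :
    bernoulliWeight (s.erase i) p (Function.update b i c) = bernoulliWeight (s.erase i) p b :=
  Finset.prod_congr rfl fun j hj => by
    rw [Function.update_of_ne (Finset.ne_of_mem_erase hj)]

theorem bernoulliWeight_eq_mul_erase {ι : Type*} [DecidableEq ι] {s : Finset ι} (p : ℝ)
    (b : ι → Bool) {i : ι} (hi : i ∈ s) :
    bernoulliWeight s p b = (if b i then p else 1 - p) * bernoulliWeight (s.erase i) p b :=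
  (Finset.mul_prod_erase s (fun j => if b j then p else 1 - p) hi).symm

open Classical in
/-- The signed sum over an increasing event, with coordinate `i` left out of the weight, is the
total weight of the configurations for which coordinate `i` is pivotal. -/
theorem sum_signed_bernoulliWeight_erase {ι : Type*} [Fintype ι] [DecidableEq ι]
    {A : Set (ι → Bool)} (hA : IsUpperSet A) (p : ℝ) (i : ι) :
    (∑ b, if b ∈ A then
        bernoulliWeight (Finset.univ.erase i) p b * (if b i then 1 else -1) else 0) =
      ∑ b, if Xor (Function.update b i true ∈ A) (Function.update b i false ∈ A) then
        bernoulliWeight Finset.univ p b else 0 := by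
  rw [← sub_eq_zero, ← Finset.sum_sub_distrib]
  refine Finset.sum_involution (fun b _ => Function.update b i (!b i)) (fun b _ => ?_)
    (fun b _ _ h => ?_) (fun _ _ => Finset.mem_univ _) (fun b _ => ?_)
  · have hmono : Function.update b i false ∈ A → Function.update b i true ∈ A :=
      hA (update_le_update_iff.2 ⟨Bool.false_le _, fun _ _ => le_rfl⟩)
    have hself : b = Function.update b i (b i) := (Function.update_eq_self i b).symm
    simp only [bernoulliWeight_eq_mul_erase p _ (Finset.mem_univ i),
      bernoulliWeight_erase_update, Function.update_self, Function.update_idem]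
    generalize bernoulliWeight (Finset.univ.erase i) p b = r
    have hmem : b ∈ A ↔ Function.update b i (b i) ∈ A := by rw [← hself]
    simp only [hmem]
    cases b i <;> by_cases hf : Function.update b i false ∈ A <;>
      by_cases ht : Function.update b i true ∈ A <;>
      first
      | exact absurd (hmono hf) ht
      | simp [hf, ht, Xor, sub_mul]
  · simpa using congrFun h i
  · simp

/-- **Russo–Margulis formula.** Let `μ p` be the product Bernoulli measure on
`{false, true}ⁿ` with parameter `p` (characterized by the probabilities of singletons),
and let `A` be an increasing event.  Then for `p ∈ (0,1)` the map `p ↦ μ_p(A)` is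
differentiable at `p`, with derivative the sum over coordinates `i` of the influence
of coordinate `i`, i.e. the `μ_p`-probability that exactly one of the two configurations
obtained by setting coordinate `i` to `true`, respectively `false`, lies in `A`. -/
theorem russo_margulis_formula
    (n : ℕ) (hn : 0 < n)
    (μ : ℝ → Measure (Fin n → Bool))
    (hμ : ∀ p ∈ Set.Icc (0 : ℝ) 1, IsProbabilityMeasure (μ p) ∧
      ∀ b : Fin n → Bool,
        μ p {b} = ∏ i, (if b i then ENNReal.ofReal p else ENNReal.ofReal (1 - p)))
    (A : Set (Fin n → Bool))
    (hA : ∀ ω ω' : Fin n → Bool, ω ∈ A → (∀ i, ω i ≤ ω' i) → ω' ∈ A)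
    (p : ℝ) (hp : p ∈ Set.Ioo (0 : ℝ) 1) :
    HasDerivAt (fun q : ℝ => (μ q A).toReal)
      (∑ i : Fin n,
        (μ p {ω | Xor' (Function.update ω i true ∈ A) (Function.update ω i false ∈ A)}).toReal)
      p := by
  classical
  have hsum : ∀ q ∈ Set.Icc (0 : ℝ) 1, ∀ S : Set (Fin n → Bool),
      (μ q S).toReal = ∑ b, if b ∈ S then bernoulliWeight Finset.univ q b else 0 := by
    intro q hq S
    obtain ⟨_, hmass⟩ := hμ q hq
    rw [toReal_measure_eq_sum_ite]
    refine Finset.sum_congr rfl fun b _ => ?_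
    congr 1
    rw [hmass, ENNReal.toReal_prod]
    refine Finset.prod_congr rfl fun i _ => ?_
    split_ifs
    · exact ENNReal.toReal_ofReal hq.1
    · exact ENNReal.toReal_ofReal (sub_nonneg.2 hq.2)
  have hderiv : HasDerivAt
      (fun q => ∑ b, if b ∈ A then bernoulliWeight Finset.univ q b else 0)
      (∑ b, if b ∈ A then ∑ i, bernoulliWeight (Finset.univ.erase i) p b *
        (if b i then 1 else -1) else 0) p := by
    refine HasDerivAt.fun_sum fun b _ => ?_
    split_ifs
    · exact hasDerivAt_bernoulliWeight Finset.univ p b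
    · exact hasDerivAt_const p 0
  have hnhds : Set.Icc (0 : ℝ) 1 ∈ nhds p := Icc_mem_nhds hp.1 hp.2
  refine (hderiv.congr_of_eventuallyEq
    (Filter.eventually_of_mem hnhds fun q hq => hsum q hq A)).congr_deriv ?_
  have hup : IsUpperSet A := fun ω ω' hle hω => hA ω ω' hω hle
  have hinfl : ∀ i, (μ p {ω | Xor (Function.update ω i true ∈ A)
      (Function.update ω i false ∈ A)}).toReal = ∑ b, if b ∈ A then
        bernoulliWeight (Finset.univ.erase i) p b * (if b i then 1 else -1) else 0 := by
    intro i
    rw [hsum p (Set.Ioo_subset_Icc_self hp), sum_signed_bernoulliWeight_erase hup]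
    exact Finset.sum_congr rfl fun b _ => by congr 1
  refine Eq.trans ?_ (Finset.sum_congr rfl fun i _ => (hinfl i).symm)
  rw [Finset.sum_comm]
  refine Finset.sum_congr rfl fun b _ => ?_
  split_ifs <;> simp
end

section
/- Pitt's theorem: Let X = (X₁, …, Xₙ) be a jointly Gaussian random vector. Then the covariance Cov(Xᵢ, Xⱼ) is nonnegative for all i, j if and only if X is positively associated, i.e. for all bounded measurable functions f, g : ℝⁿ → ℝ that are nondecreasing in each coordinate, Cov(f(X), g(X)) ≥ 0. -/
open MeasureTheory ProbabilityTheory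

open Filter Topology

section PositiveAssociation

variable {ι : Type*} [Fintype ι]

theorem integrable_coord (μ : Measure (ι → ℝ)) [IsGaussian μ] (i : ι) :
    Integrable (fun x : ι → ℝ => x i) μ :=
  IsGaussian.integrable_dual μ (ContinuousLinearMap.proj i)

theorem memLp_coord (μ : Measure (ι → ℝ)) [IsGaussian μ] (i : ι) :
    MemLp (fun x : ι → ℝ => x i) 2 μ :=
  IsGaussian.memLp_dual μ (ContinuousLinearMap.proj i) 2 (by simp)

/-- Under a centered Gaussian measure with nonnegative covariances, every bounded nondecreasing
function is nonnegatively correlated with each coordinate. -/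
theorem integral_mul_coord_nonneg {μ : Measure (ι → ℝ)} [IsGaussian μ]
    (hmean : ∀ i, ∫ x, x i ∂μ = 0) (hcov : ∀ i j, 0 ≤ ∫ x, x i * x j ∂μ)
    {h : (ι → ℝ) → ℝ} (hm : Measurable h) {C : ℝ} (hC : ∀ x, |h x| ≤ C) (hmono : Monotone h)
    (j : ι) : 0 ≤ ∫ x, h x * x j ∂μ := by
  set v := ∫ x, x j * x j ∂μ with hv
  have hsq (i : ι) : Integrable (fun x : ι → ℝ => x i * x j) μ :=
    (memLp_coord μ i).integrable_mul (memLp_coord μ j)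
  by_cases hv0 : v = 0
  · have h0 : (fun x : ι → ℝ => x j * x j) =ᵐ[μ] 0 :=
      (integral_eq_zero_iff_of_nonneg (fun x => mul_self_nonneg _) (hsq j)).1 hv0
    refine (integral_eq_zero_of_ae ?_).ge
    filter_upwards [h0] with x hx
    have : x j = 0 := by simpa using hx
    simp [this]
  set a : ι → ℝ := fun i => (∫ x, x i * x j ∂μ) / v with ha
  have ha0 : 0 ≤ a := fun i => div_nonneg (hcov i j) (hcov j j)
  set R : (ι → ℝ) → ι → ℝ := fun x i => x i - a i * x j with hR
  have hRm : Measurable R := by fun_prop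
  have hind : IndepFun R (fun x : ι → ℝ => x j) μ := by
    have hlaw : HasGaussianLaw (fun x : ι → ℝ => (fun i => R x i, fun _ : Unit => x j)) μ :=
      IsGaussian.hasGaussianLaw_id.map
        (((ContinuousLinearMap.pi fun i =>
          ContinuousLinearMap.proj i - a i • ContinuousLinearMap.proj j)).prod
          (ContinuousLinearMap.pi fun _ : Unit =>
            (ContinuousLinearMap.proj j : (ι → ℝ) →L[ℝ] ℝ)))
    have := hlaw.indepFun_of_covariance_eval (X := fun i x => R x i) (Y := fun _ x => x j)
      (fun i _ => by
        change cov[(fun x => x i) - fun x => a i * x j, fun x => x j; μ] = 0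
        rw [covariance_eq_sub ((memLp_coord μ i).sub ((memLp_coord μ j).const_mul (a i)))
          (memLp_coord μ j)]
        simp only [Pi.mul_apply, hmean, mul_zero, sub_zero, Pi.sub_apply, sub_mul, mul_assoc]
        rw [integral_sub (hsq i) ((hsq j).const_mul _), integral_const_mul, ← hv, ha]
        field_simp
        simp)
    exact this.comp measurable_id (measurable_pi_apply ())
  have hzero : ∫ x, h (R x) * x j ∂μ = 0 := by
    have := (hind.comp hm measurable_id).integral_fun_mul_eq_mul_integral
      (hm.comp hRm).aestronglyMeasurable (measurable_pi_apply j).aestronglyMeasurable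
    simpa [hmean] using this
  rw [← hzero]
  have hint (k : (ι → ℝ) → ι → ℝ) (hk : Measurable k) :
      Integrable (fun x => h (k x) * x j) μ :=
    (integrable_coord μ j).bdd_mul (hm.comp hk).aestronglyMeasurable
      (ae_of_all _ fun x => hC (k x))
  refine integral_mono (hint R hRm) (hint _ measurable_id) fun x => ?_
  rcases le_total 0 (x j) with hx | hx
  · exact mul_le_mul_of_nonneg_right
      (hmono fun i => by have := mul_nonneg (ha0 i) hx; simp only [hR]; linarith) hx
  · exact mul_le_mul_of_nonpos_right
      (hmono fun i => by
        have := mul_nonpos_of_nonneg_of_nonpos (ha0 i) hx; simp only [hR]; linarith) hx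

theorem fderiv_single_nonneg [DecidableEq ι] {g : (ι → ℝ) → ℝ} (hg : Monotone g) {x : ι → ℝ}
    (hd : DifferentiableAt ℝ g x) (i : ι) : 0 ≤ fderiv ℝ g x (Pi.single i 1) := by
  have h1 : HasDerivAt (fun t : ℝ => g (x + t • Pi.single i 1))
      (fderiv ℝ g x (Pi.single i 1)) 0 := by
    have := hd.hasFDerivAt.hasLineDerivAt (Pi.single i 1)
    simpa [HasLineDerivAt] using this
  rw [← h1.deriv]
  refine Monotone.deriv_nonneg fun s t hst => hg ?_
  have : (0 : ι → ℝ) ≤ Pi.single i 1 := by simp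
  gcongr

/-- Positive association of a centered Gaussian measure with nonnegative covariances, tested
against a smooth function. -/
theorem integral_mul_le_of_contDiff {μ : Measure (ι → ℝ)} [IsGaussian μ]
    (hmean : ∀ i, ∫ x, x i ∂μ = 0) (hcov : ∀ i j, 0 ≤ ∫ x, x i * x j ∂μ)
    {f g : (ι → ℝ) → ℝ} (hf : Measurable f) {C : ℝ} (hC : ∀ x, |f x| ≤ C) (hfm : Monotone f)
    (hg : ContDiff ℝ 1 g) {D : ℝ} (hD : ∀ x, |g x| ≤ D) (hgm : Monotone g)
    {K : NNReal} (hK : LipschitzWith K g) :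
    (∫ x, f x ∂μ) * (∫ x, g x ∂μ) ≤ ∫ x, f x * g x ∂μ := by
  classical
  have hC0 : 0 ≤ C := (abs_nonneg _).trans (hC 0)
  let ν := μ.prod μ
  let Y (θ : ℝ) (p : (ι → ℝ) × (ι → ℝ)) : ι → ℝ := Real.cos θ • p.1 + Real.sin θ • p.2
  let W (θ : ℝ) (p : (ι → ℝ) × (ι → ℝ)) : ι → ℝ := -Real.sin θ • p.1 + Real.cos θ • p.2
  let F (θ : ℝ) : ℝ := ∫ p, f p.1 * g (Y θ p) ∂ν
  let k (θ : ℝ) (p : (ι → ℝ) × (ι → ℝ)) : ℝ := f p.1 * fderiv ℝ g (Y θ p) (W θ p)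
  have hdiff : Differentiable ℝ g := hg.differentiable one_ne_zero
  have hYc (θ : ℝ) : Continuous (Y θ) := by fun_prop
  have hWc (θ : ℝ) : Continuous (W θ) := by fun_prop
  have hDg : Continuous (fderiv ℝ g) := hg.continuous_fderiv one_ne_zero
  have hkm (θ : ℝ) : Measurable (k θ) :=
    (hf.comp measurable_fst).mul ((hDg.comp (hYc θ)).clm_apply (hWc θ)).measurable
  have hfgm (θ : ℝ) : Measurable fun p => f p.1 * g (Y θ p) :=
    (hf.comp measurable_fst).mul (hg.continuous.comp (hYc θ)).measurable
  have hWle (θ : ℝ) (p) : ‖W θ p‖ ≤ ‖p.1‖ + ‖p.2‖ := by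
    refine (norm_add_le _ _).trans ?_
    rw [norm_smul, norm_smul, norm_neg]
    have h1 := mul_le_mul_of_nonneg_right (Real.abs_sin_le_one θ) (norm_nonneg p.1)
    have h2 := mul_le_mul_of_nonneg_right (Real.abs_cos_le_one θ) (norm_nonneg p.2)
    simp only [Real.norm_eq_abs]
    linarith
  have hkle (θ : ℝ) (p) : ‖k θ p‖ ≤ C * (K * (‖p.1‖ + ‖p.2‖)) := by
    rw [norm_mul]
    refine mul_le_mul (hC _) ?_ (norm_nonneg _) hC0
    refine (ContinuousLinearMap.le_opNorm _ _).trans ?_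
    exact mul_le_mul (norm_fderiv_le_of_lipschitz ℝ hK) (hWle θ p) (norm_nonneg _) K.2
  have hbint : Integrable (fun p : (ι → ℝ) × (ι → ℝ) => C * (K * (‖p.1‖ + ‖p.2‖))) ν := by
    have hn : Integrable (fun x : ι → ℝ => ‖x‖) μ := (IsGaussian.integrable_id (μ := μ)).norm
    exact (((hn.comp_fst μ).add (hn.comp_snd μ)).const_mul _).const_mul _
  have hkint (θ : ℝ) : Integrable (k θ) ν :=
    hbint.mono' (hkm θ).aestronglyMeasurable (ae_of_all _ (hkle θ))
  have hderiv (θ : ℝ) : HasDerivAt F (∫ p, k θ p ∂ν) θ := by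
    refine (hasDerivAt_integral_of_dominated_loc_of_deriv_le (s := Set.univ) (F' := k)
      univ_mem (Eventually.of_forall fun t => (hfgm t).aestronglyMeasurable) ?_
      (hkm θ).aestronglyMeasurable (ae_of_all _ fun p t _ => hkle t p) hbint
      (ae_of_all _ fun p t _ => ?_)).2
    · refine Integrable.of_bound (hfgm θ).aestronglyMeasurable (C * D) (ae_of_all _ fun p => ?_)
      rw [norm_mul]
      exact mul_le_mul (hC _) (hD _) (norm_nonneg _) hC0
    · have hY : HasDerivAt (fun s => Y s p) (W t p) t :=
        ((Real.hasDerivAt_cos t).smul_const p.1).add ((Real.hasDerivAt_sin t).smul_const p.2)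
      exact ((hdiff _).hasFDerivAt.comp_hasDerivAt t hY).const_mul (f p.1)
  have hrot (θ : ℝ) : ν.map (ContinuousLinearMap.rotation θ) = ν :=
    IsGaussian.map_rotation_eq_self_of_forall_strongDual_eq_zero (fun L => by
      rw [IsGaussian.integral_dual]
      convert map_zero L
      ext i
      rw [eval_integral (integrable_coord μ)]
      exact hmean i) θ
  have hneg (θ : ℝ) (hθ : 0 ≤ Real.sin θ) : ∫ p, k θ p ∂ν ≤ 0 := by
    have hrm : Measurable (ContinuousLinearMap.rotation (-θ) :
        (ι → ℝ) × (ι → ℝ) →L[ℝ] (ι → ℝ) × (ι → ℝ)) := by fun_prop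
    have hkrot (p) : k θ (ContinuousLinearMap.rotation (-θ) p) =
        f (Real.cos θ • p.1 - Real.sin θ • p.2) * fderiv ℝ g p.1 p.2 := by
      have h1 := Real.sin_sq_add_cos_sq θ
      have hY : Y θ (ContinuousLinearMap.rotation (-θ) p) = p.1 := by
        ext i
        simp only [Y, ContinuousLinearMap.rotation_apply, Real.cos_neg, Real.sin_neg,
          Pi.add_apply, Pi.smul_apply, smul_eq_mul]
        linear_combination p.1 i * h1
      have hW : W θ (ContinuousLinearMap.rotation (-θ) p) = p.2 := by
        ext i
        simp only [W, ContinuousLinearMap.rotation_apply, Real.cos_neg, Real.sin_neg,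
          Pi.add_apply, Pi.smul_apply, smul_eq_mul]
        linear_combination p.2 i * h1
      simp only [k, hY, hW]
      simp [ContinuousLinearMap.rotation_apply, sub_eq_add_neg]
    have hi : Integrable (fun p => k θ (ContinuousLinearMap.rotation (-θ) p)) ν :=
      Integrable.comp_measurable (g := k θ) (by rw [hrot]; exact hkint θ) hrm
    have heq : ∫ p, k θ p ∂ν = ∫ p, k θ (ContinuousLinearMap.rotation (-θ) p) ∂ν := by
      conv_lhs => rw [← hrot (-θ)]
      exact integral_map hrm.aemeasurable (hkm θ).aestronglyMeasurable
    rw [heq, integral_prod _ hi]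
    refine integral_nonpos fun y => ?_
    simp only [hkrot, Pi.zero_apply]
    have hfw : Measurable fun w : ι → ℝ => f (Real.cos θ • y - Real.sin θ • w) :=
      hf.comp (by fun_prop)
    have hexp (w : ι → ℝ) : f (Real.cos θ • y - Real.sin θ • w) * fderiv ℝ g y w =
        ∑ i, fderiv ℝ g y (Pi.single i 1) * (f (Real.cos θ • y - Real.sin θ • w) * w i) := by
      have hw := congrArg (fderiv ℝ g y) (pi_eq_sum_univ' w)
      rw [map_sum] at hw
      rw [hw, Finset.mul_sum]
      refine Finset.sum_congr rfl fun i _ => ?_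
      rw [map_smul, smul_eq_mul]
      ring
    simp only [hexp]
    rw [integral_finsetSum _ fun i _ => ((integrable_coord μ i).bdd_mul
      hfw.aestronglyMeasurable (ae_of_all _ fun w => hC _)).const_mul _]
    refine Finset.sum_nonpos fun i _ => ?_
    rw [integral_const_mul]
    refine mul_nonpos_of_nonneg_of_nonpos (fderiv_single_nonneg hgm (hdiff y) i) ?_
    have := integral_mul_coord_nonneg hmean hcov hfw.neg
      (fun w => by simpa using hC (Real.cos θ • y - Real.sin θ • w)) (fun w w' hw => by
        simp only [Pi.neg_apply, neg_le_neg_iff]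
        exact hfm (by gcongr)) i
    simpa [integral_neg] using this
  have hanti : AntitoneOn F (Set.Icc 0 (Real.pi / 2)) := by
    refine antitoneOn_of_deriv_nonpos (convex_Icc _ _)
      (fun θ _ => (hderiv θ).continuousAt.continuousWithinAt)
      (fun θ _ => (hderiv θ).differentiableAt.differentiableWithinAt) fun θ hθ => ?_
    rw [interior_Icc] at hθ
    rw [(hderiv θ).deriv]
    exact hneg θ (Real.sin_nonneg_of_nonneg_of_le_pi hθ.1.le (by linarith [hθ.2, Real.pi_pos]))
  have hle := hanti (Set.left_mem_Icc.2 (by positivity)) (Set.right_mem_Icc.2 (by positivity))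
    (by positivity)
  have h0 : F 0 = ∫ x, f x * g x ∂μ := by
    simp only [F, Y, Real.cos_zero, Real.sin_zero, one_smul, zero_smul, add_zero]
    exact integral_fun_fst (μ := μ) (ν := μ) (fun x => f x * g x) |>.trans (by simp)
  have h1 : F (Real.pi / 2) = (∫ x, f x ∂μ) * ∫ x, g x ∂μ := by
    simp only [F, Y, Real.cos_pi_div_two, Real.sin_pi_div_two, one_smul, zero_smul, zero_add]
    exact integral_prod_mul f g
  rwa [h0, h1] at hle

/-- A bounded nondecreasing Lipschitz function is a uniform limit of smooth functions with the same
bound, monotonicity and Lipschitz constant. -/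
theorem exists_contDiff_monotone_approx {g : (ι → ℝ) → ℝ} {D : ℝ} (hD : ∀ x, |g x| ≤ D)
    (hgm : Monotone g) {K : NNReal} (hK : LipschitzWith K g) {ε : ℝ} (hε : 0 < ε) :
    ∃ g' : (ι → ℝ) → ℝ, ContDiff ℝ 1 g' ∧ (∀ x, |g' x| ≤ D) ∧ Monotone g' ∧ LipschitzWith K g' ∧
      ∀ x, |g' x - g x| ≤ ε := by
  obtain ⟨δ, hδ, hδε⟩ := Metric.uniformContinuous_iff.1 hK.uniformContinuous ε hε
  let φ : ContDiffBump (0 : ι → ℝ) := ⟨δ / 2, δ, half_pos hδ, half_lt_self hδ⟩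
  let w := φ.normed volume
  have hw0 (t) : 0 ≤ w t := φ.nonneg_normed t
  have hwi : Integrable w := φ.integrable_normed
  have hw1 : ∫ t, w t = 1 := φ.integral_normed
  let g' : (ι → ℝ) → ℝ := convolution w g (ContinuousLinearMap.lsmul ℝ ℝ) volume
  have hg' (x) : g' x = ∫ t, w t * g (x - t) := rfl
  have hint (x) : Integrable fun t => w t * g (x - t) :=
    hwi.mul_bdd (hK.continuous.comp (by fun_prop)).aestronglyMeasurable
      (ae_of_all _ fun t => hD (x - t))
  refine ⟨g', ?_, fun x => ?_, fun x y hxy => ?_, ?_, fun x => ?_⟩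
  · exact φ.hasCompactSupport_normed.contDiff_convolution_left (n := 1) _ φ.contDiff_normed
      hK.continuous.locallyIntegrable
  · rw [hg', ← Real.norm_eq_abs]
    calc _ ≤ ∫ t, w t * D := norm_integral_le_of_norm_le (hwi.mul_const D) (ae_of_all _ fun t => by
            rw [norm_mul, Real.norm_of_nonneg (hw0 t)]
            exact mul_le_mul_of_nonneg_left (hD _) (hw0 t))
      _ = D := by rw [integral_mul_const, hw1, one_mul]
  · exact integral_mono (hint x) (hint y) fun t =>
      mul_le_mul_of_nonneg_left (hgm (sub_le_sub_right hxy t)) (hw0 t)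
  · refine LipschitzWith.of_dist_le_mul fun x y => ?_
    rw [dist_eq_norm, hg', hg', ← integral_sub (hint x) (hint y)]
    calc _ ≤ ∫ t, w t * (K * dist x y) :=
          norm_integral_le_of_norm_le (hwi.mul_const _) (ae_of_all _ fun t => by
            rw [← mul_sub, norm_mul, Real.norm_of_nonneg (hw0 t), ← dist_eq_norm]
            refine mul_le_mul_of_nonneg_left ?_ (hw0 t)
            simpa using hK.dist_le_mul (x - t) (y - t))
      _ = K * dist x y := by rw [integral_mul_const, hw1, one_mul]
  · exact ContDiffBump.dist_normed_convolution_le hK.continuous.aestronglyMeasurable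
      fun y hy => (hδε hy).le

/-- If integration against a bounded weight is nonnegative on smooth bounded nondecreasing
Lipschitz functions, then so it is on all bounded nondecreasing Lipschitz functions. -/
theorem integral_mul_nonneg_of_lipschitz {μ : Measure (ι → ℝ)} [IsProbabilityMeasure μ]
    {φ : (ι → ℝ) → ℝ} (hφ : Integrable φ μ)
    (H : ∀ g : (ι → ℝ) → ℝ, ContDiff ℝ 1 g → (∃ D, ∀ x, |g x| ≤ D) → Monotone g →
      (∃ K, LipschitzWith K g) → 0 ≤ ∫ x, φ x * g x ∂μ)
    {g : (ι → ℝ) → ℝ} {D : ℝ} (hD : ∀ x, |g x| ≤ D)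
    (hgm : Monotone g) {K : NNReal} (hK : LipschitzWith K g) : 0 ≤ ∫ x, φ x * g x ∂μ := by
  choose g' hg'c hg'D hg'm hg'K hg'g using fun k : ℕ =>
    exists_contDiff_monotone_approx hD hgm hK (Nat.one_div_pos_of_nat (α := ℝ) (n := k))
  have hlim : Tendsto (fun k => ∫ x, φ x * g' k x ∂μ) atTop (𝓝 (∫ x, φ x * g x ∂μ)) := by
    refine tendsto_integral_of_dominated_convergence (fun x => ‖φ x‖ * D) (fun k => ?_)
      (hφ.norm.mul_const D) (fun k => ae_of_all _ fun x => ?_) (ae_of_all _ fun x => ?_)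
    · exact hφ.aestronglyMeasurable.mul (hg'c k).continuous.aestronglyMeasurable
    · rw [norm_mul]
      exact mul_le_mul_of_nonneg_left (hg'D k x) (norm_nonneg _)
    · refine Tendsto.const_mul _ (tendsto_iff_dist_tendsto_zero.2 ?_)
      exact squeeze_zero (fun _ => dist_nonneg) (fun k => hg'g k x)
        tendsto_one_div_add_atTop_nhds_zero_nat
  exact ge_of_tendsto' hlim fun k => H _ (hg'c k) ⟨D, hg'D k⟩ (hg'm k) ⟨K, hg'K k⟩

theorem IsUpperSet.antitone_infDist {U : Set (ι → ℝ)} (hU : IsUpperSet U) :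
    Antitone fun x => Metric.infDist x U := by
  intro x y hxy
  rcases U.eq_empty_or_nonempty with rfl | hne
  · simp
  refine (Metric.le_infDist hne).2 fun u hu => ?_
  have h : u + (y - x) ∈ U := hU (le_add_of_nonneg_right (sub_nonneg.2 hxy)) hu
  calc Metric.infDist y U ≤ dist y (u + (y - x)) := Metric.infDist_le_dist_of_mem h
    _ = dist x u := by
      rw [dist_eq_norm, dist_eq_norm]
      congr 1
      abel

theorem setIntegral_nonneg_of_isClosed_isUpperSet {μ : Measure (ι → ℝ)} [IsProbabilityMeasure μ]
    {φ : (ι → ℝ) → ℝ} (hφ : Integrable φ μ)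
    (H : ∀ g : (ι → ℝ) → ℝ, (∃ D, ∀ x, |g x| ≤ D) → Monotone g →
      (∃ K, LipschitzWith K g) → 0 ≤ ∫ x, φ x * g x ∂μ)
    {U : Set (ι → ℝ)} (hUc : IsClosed U) (hU : IsUpperSet U) : 0 ≤ ∫ x in U, φ x ∂μ := by
  rcases U.eq_empty_or_nonempty with rfl | hne
  · simp
  rw [← integral_indicator hUc.measurableSet]
  let g (k : ℕ) (x : ι → ℝ) : ℝ := max 0 (1 - k * Metric.infDist x U)
  have hg0 (k x) : 0 ≤ g k x := le_max_left _ _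
  have hg1 (k x) : g k x ≤ 1 :=
    max_le zero_le_one (sub_le_self _ (mul_nonneg k.cast_nonneg Metric.infDist_nonneg))
  have hgD (k x) : |g k x| ≤ 1 := by rw [abs_of_nonneg (hg0 k x)]; exact hg1 k x
  have hgL (k : ℕ) : LipschitzWith k (g k) := by
    have h1 : LipschitzWith k fun x => 1 - (k : ℝ) * Metric.infDist x U := by
      refine LipschitzWith.of_dist_le_mul fun x y => ?_
      have := (Metric.lipschitz_infDist_pt U).dist_le_mul x y
      rw [Real.dist_eq] at this ⊢
      rw [show 1 - (k : ℝ) * Metric.infDist x U - (1 - k * Metric.infDist y U) =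
        -(k * (Metric.infDist x U - Metric.infDist y U)) by ring, abs_neg, abs_mul, Nat.abs_cast]
      simpa using mul_le_mul_of_nonneg_left this k.cast_nonneg
    exact h1.const_max 0
  have hgm (k : ℕ) : Monotone (g k) := fun x y hxy =>
    max_le_max le_rfl (sub_le_sub_left
      (mul_le_mul_of_nonneg_left (hU.antitone_infDist hxy) k.cast_nonneg) _)
  have hlim : Tendsto (fun k => ∫ x, φ x * g k x ∂μ) atTop (𝓝 (∫ x, U.indicator φ x ∂μ)) := by
    refine tendsto_integral_of_dominated_convergence (fun x => ‖φ x‖) (fun k => ?_)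
      hφ.norm (fun k => ae_of_all _ fun x => ?_) (ae_of_all _ fun x => ?_)
    · exact hφ.aestronglyMeasurable.mul (hgL k).continuous.aestronglyMeasurable
    · rw [norm_mul]
      exact mul_le_of_le_one_right (norm_nonneg _) (hgD k x)
    · by_cases hx : x ∈ U
      · simp [hx, g, Metric.infDist_zero_of_mem hx]
      · have hpos : 0 < Metric.infDist x U := (hUc.notMem_iff_infDist_pos hne).1 hx
        obtain ⟨N, hN⟩ := exists_nat_gt (1 / Metric.infDist x U)
        refine tendsto_const_nhds.congr' ?_
        filter_upwards [eventually_ge_atTop N] with k hk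
        have : 1 ≤ k * Metric.infDist x U := by
          rw [← div_le_iff₀ hpos]
          exact hN.le.trans (by exact_mod_cast hk)
        simp [hx, g, this]
  exact ge_of_tendsto' hlim fun k => H _ ⟨1, hgD k⟩ (hgm k) ⟨k, hgL k⟩

theorem setIntegral_nonneg_of_isUpperSet {μ : Measure (ι → ℝ)} [IsProbabilityMeasure μ]
    {φ : (ι → ℝ) → ℝ} (hφ : Integrable φ μ)
    (H : ∀ U : Set (ι → ℝ), IsClosed U → IsUpperSet U → 0 ≤ ∫ x in U, φ x ∂μ)
    {A : Set (ι → ℝ)} (hAm : MeasurableSet A) (hA : IsUpperSet A) : 0 ≤ ∫ x in A, φ x ∂μ := by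
  have hex (k : ℕ) : ∃ U ⊆ A, IsClosed U ∧ IsUpperSet U ∧ μ (A \ U) < 1 / ((k : ENNReal) + 1) := by
    obtain ⟨S, hSA, hS, hlt⟩ := hAm.exists_isCompact_sdiff_lt (μ := μ) (measure_ne_top μ A)
      (ε := 1 / ((k : ENNReal) + 1)) (by simp)
    refine ⟨upperClosure S, upperClosure_min hSA hA,
      hS.isClosed.upperClosure_pi hS.isBounded.bddBelow, (upperClosure S).upper, ?_⟩
    exact (measure_mono (Set.sdiff_subset_sdiff_right subset_upperClosure)).trans_lt hlt
  choose U hUA hUc hU hlt using hex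
  have hlim0 : Tendsto (fun k => ∫ x in A \ U k, φ x ∂μ) atTop (𝓝 0) := by
    refine hφ.tendsto_setIntegral_nhds_zero ?_
    refine tendsto_of_tendsto_of_tendsto_of_le_of_le tendsto_const_nhds ?_
      (fun _ => zero_le) (fun k => (hlt k).le)
    have h := ENNReal.tendsto_inv_nat_nhds_zero.comp (tendsto_add_atTop_nat 1)
    simpa [Function.comp_def] using h
  have hlim : Tendsto (fun k => ∫ x in U k, φ x ∂μ) atTop (𝓝 (∫ x in A, φ x ∂μ)) := by
    have h := (tendsto_const_nhds (x := ∫ x in A, φ x ∂μ)).sub hlim0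
    rw [sub_zero] at h
    refine h.congr fun k => ?_
    rw [setIntegral_sdiff (hUc k).measurableSet hφ.integrableOn (hUA k), sub_sub_cancel]
  exact ge_of_tendsto' hlim fun k => H _ (hUc k) (hU k)

theorem integral_mul_nonneg_of_monotone {μ : Measure (ι → ℝ)} [IsProbabilityMeasure μ]
    {φ : (ι → ℝ) → ℝ} (hφ : Integrable φ μ) (hφ0 : ∫ x, φ x ∂μ = 0)
    (H : ∀ A : Set (ι → ℝ), MeasurableSet A → IsUpperSet A → 0 ≤ ∫ x in A, φ x ∂μ)
    {g : (ι → ℝ) → ℝ} (hg : Measurable g) {D : ℝ} (hD : ∀ x, |g x| ≤ D) (hgm : Monotone g) :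
    0 ≤ ∫ x, φ x * g x ∂μ := by
  let τ := volume.restrict (Set.Ioc (-D) D)
  let S : Set ((ι → ℝ) × ℝ) := {p | p.2 < g p.1}
  have hS : MeasurableSet S := measurableSet_lt measurable_snd (hg.comp measurable_fst)
  have hlayer (x) : ∫ t, S.indicator (fun p => φ p.1) (x, t) ∂τ = φ x * g x + D * φ x := by
    have h1 : (fun t => S.indicator (fun p => φ p.1) (x, t)) =
        (Set.Iio (g x)).indicator fun _ => φ x := by
      ext t
      simp [S, Set.indicator_apply]
    have h2 : Set.Iio (g x) ∩ Set.Ioc (-D) D = Set.Ioo (-D) (g x) := by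
      ext t
      have := (abs_le.1 (hD x)).2
      simp only [Set.mem_inter_iff, Set.mem_Iio, Set.mem_Ioc, Set.mem_Ioo]
      constructor
      · exact fun h => ⟨h.2.1, h.1⟩
      · exact fun h => ⟨h.2, h.1, h.2.le.trans this⟩
    rw [h1, integral_indicator measurableSet_Iio, setIntegral_const]
    simp only [τ, measureReal_restrict_apply measurableSet_Iio, h2, smul_eq_mul]
    rw [Real.volume_real_Ioo_of_le (abs_le.1 (hD x)).1]
    ring
  have hint : Integrable (S.indicator fun p => φ p.1) (μ.prod τ) :=
    (hφ.comp_fst τ).indicator hS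
  have hgi : Integrable (fun x => φ x * g x) μ :=
    hφ.mul_bdd hg.aestronglyMeasurable (ae_of_all _ hD)
  have key : ∫ x, φ x * g x ∂μ = ∫ t, ∫ x, S.indicator (fun p => φ p.1) (x, t) ∂μ ∂τ := by
    rw [← integral_integral_swap (f := fun x t => S.indicator (fun p => φ p.1) (x, t)) hint]
    simp only [hlayer]
    rw [integral_add hgi (hφ.const_mul D), integral_const_mul, hφ0, mul_zero, add_zero]
  rw [key]
  refine integral_nonneg fun t => ?_
  have hA : MeasurableSet {x | t < g x} := measurableSet_lt measurable_const hg
  have h3 : (fun x => S.indicator (fun p => φ p.1) (x, t)) = {x | t < g x}.indicator φ := by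
    ext x
    simp [S, Set.indicator_apply]
  simp only [h3, Pi.zero_apply]
  rw [integral_indicator hA]
  exact H _ hA fun x y hxy hx => lt_of_lt_of_le hx (hgm hxy)

/-- A centered Gaussian measure with nonnegative covariances is positively associated. -/
theorem integral_mul_le_of_monotone {μ : Measure (ι → ℝ)} [IsGaussian μ]
    (hmean : ∀ i, ∫ x, x i ∂μ = 0) (hcov : ∀ i j, 0 ≤ ∫ x, x i * x j ∂μ)
    {f g : (ι → ℝ) → ℝ} (hf : Measurable f) {C : ℝ} (hC : ∀ x, |f x| ≤ C) (hfm : Monotone f)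
    (hg : Measurable g) {D : ℝ} (hD : ∀ x, |g x| ≤ D) (hgm : Monotone g) :
    (∫ x, f x ∂μ) * (∫ x, g x ∂μ) ≤ ∫ x, f x * g x ∂μ := by
  have hfi : Integrable f μ := Integrable.of_bound hf.aestronglyMeasurable C (ae_of_all _ hC)
  have hφ : Integrable (fun x => f x - ∫ y, f y ∂μ) μ := hfi.sub (integrable_const _)
  have hφ0 : ∫ x, (f x - ∫ y, f y ∂μ) ∂μ = 0 := by
    rw [integral_sub hfi (integrable_const _)]
    simp
  have hexp {h : (ι → ℝ) → ℝ} (hh : Measurable h) {B : ℝ} (hB : ∀ x, |h x| ≤ B) :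
      ∫ x, (f x - ∫ y, f y ∂μ) * h x ∂μ =
        ∫ x, f x * h x ∂μ - (∫ x, f x ∂μ) * ∫ x, h x ∂μ := by
    have hhi : Integrable h μ := Integrable.of_bound hh.aestronglyMeasurable B (ae_of_all _ hB)
    simp only [sub_mul]
    rw [integral_sub (hfi.mul_bdd hh.aestronglyMeasurable (ae_of_all _ hB)) (hhi.const_mul _),
      integral_const_mul]
  rw [← sub_nonneg, ← hexp hg hD]
  refine integral_mul_nonneg_of_monotone hφ hφ0 (fun A hAm hA => ?_) hg hD hgm
  refine setIntegral_nonneg_of_isUpperSet hφ (fun U hUc hU => ?_) hAm hA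
  refine setIntegral_nonneg_of_isClosed_isUpperSet hφ (fun h ⟨B, hB⟩ hhm ⟨K, hK⟩ => ?_) hUc hU
  refine integral_mul_nonneg_of_lipschitz hφ (fun h hc ⟨B, hB⟩ hhm ⟨K, hK⟩ => ?_) hB hhm hK
  rw [hexp hc.continuous.measurable hB, sub_nonneg]
  exact integral_mul_le_of_contDiff hmean hcov hf hC hfm hc hB hhm hK

section RandomVector

variable {Ω : Type*} [MeasurableSpace Ω] {P : Measure Ω}

theorem isGaussian_map_of_forall_sum {X : ι → Ω → ℝ} (hmeas : ∀ i, Measurable (X i))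
    (hgauss : ∀ c : ι → ℝ, ∃ (m : ℝ) (v : NNReal),
      Measure.map (fun ω => ∑ i, c i * X i ω) P = gaussianReal m v) :
    IsGaussian (P.map fun ω i => X i ω) := by
  classical
  refine isGaussian_of_map_eq_gaussianReal fun L => ?_
  obtain ⟨m, v, h⟩ := hgauss fun i => L (Pi.single i 1)
  refine ⟨m, v, ?_⟩
  rw [← h, Measure.map_map (by fun_prop) (by fun_prop)]
  congr 1
  ext ω
  have hL := congrArg L (pi_eq_sum_univ' fun i => X i ω)
  rw [map_sum] at hL
  simp only [Function.comp_apply]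
  rw [hL]
  refine Finset.sum_congr rfl fun i _ => ?_
  rw [map_smul, smul_eq_mul, mul_comm]

/-- Square integrable variables whose truncations are nonnegatively correlated are themselves
nonnegatively correlated. -/
theorem covariance_nonneg_of_truncation {Y Z : Ω → ℝ} [IsProbabilityMeasure P]
    (hY : MemLp Y 2 P) (hZ : MemLp Z 2 P)
    (H : ∀ k : ℕ, 0 ≤
      (∫ ω, max (-(k : ℝ)) (min (k : ℝ) (Y ω)) * max (-(k : ℝ)) (min (k : ℝ) (Z ω)) ∂P) -
        (∫ ω, max (-(k : ℝ)) (min (k : ℝ) (Y ω)) ∂P) *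
          ∫ ω, max (-(k : ℝ)) (min (k : ℝ) (Z ω)) ∂P) :
    0 ≤ (∫ ω, Y ω * Z ω ∂P) - (∫ ω, Y ω ∂P) * ∫ ω, Z ω ∂P := by
  let T (k : ℕ) (x : ℝ) : ℝ := max (-k) (min k x)
  have hTc (k) : Continuous (T k) := by fun_prop
  have hTle (k) (x) : ‖T k x‖ ≤ ‖x‖ := by
    have hk : (0 : ℝ) ≤ k := k.cast_nonneg
    have hx := abs_nonneg x
    refine abs_le.2 ⟨?_, max_le (by linarith [Real.norm_eq_abs x])
      ((min_le_right _ _).trans (le_abs_self x))⟩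
    exact le_max_of_le_right (le_min (by linarith [Real.norm_eq_abs x]) (neg_abs_le x))
  have hTlim (x) : Tendsto (fun k => T k x) atTop (𝓝 x) := by
    refine tendsto_const_nhds.congr' ?_
    filter_upwards [eventually_ge_atTop ⌈|x|⌉₊] with k hk
    have h := abs_le.1 (Nat.ceil_le.1 hk)
    simp [T, h.1, h.2]
  have h1 {V : Ω → ℝ} (hV : MemLp V 2 P) :
      Tendsto (fun k => ∫ ω, T k (V ω) ∂P) atTop (𝓝 (∫ ω, V ω ∂P)) :=
    tendsto_integral_of_dominated_convergence (fun ω => ‖V ω‖)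
      (fun k => (hTc k).comp_aestronglyMeasurable hV.aestronglyMeasurable)
      (hV.integrable one_le_two).norm (fun k => ae_of_all _ fun ω => hTle k _)
      (ae_of_all _ fun ω => hTlim _)
  have h2 : Tendsto (fun k => ∫ ω, T k (Y ω) * T k (Z ω) ∂P) atTop (𝓝 (∫ ω, Y ω * Z ω ∂P)) :=
    tendsto_integral_of_dominated_convergence (fun ω => ‖Y ω * Z ω‖)
      (fun k => ((hTc k).comp_aestronglyMeasurable hY.aestronglyMeasurable).mul
        ((hTc k).comp_aestronglyMeasurable hZ.aestronglyMeasurable))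
      (hY.integrable_mul hZ).norm
      (fun k => ae_of_all _ fun ω => by
        rw [norm_mul, norm_mul]
        exact mul_le_mul (hTle k _) (hTle k _) (norm_nonneg _) (norm_nonneg _))
      (ae_of_all _ fun ω => (hTlim _).mul (hTlim _))
  exact ge_of_tendsto' (h2.sub ((h1 hY).mul (h1 hZ))) H

end RandomVector

end PositiveAssociation

/-- **Pitt's theorem.** Let `X = (X₁, …, Xₙ)` be a jointly Gaussian random vector (every
linear functional of `X` has a Gaussian, possibly degenerate, distribution).  Then all
covariances `Cov(Xᵢ, Xⱼ)` are nonnegative if and only if `X` is positively associated: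
for all bounded measurable `f, g : ℝⁿ → ℝ` that are nondecreasing in each coordinate,
`Cov(f(X), g(X)) ≥ 0`. -/
theorem pitt_positive_association
    {Ω : Type*} [MeasurableSpace Ω] (P : Measure Ω) [IsProbabilityMeasure P]
    (n : ℕ) (X : Fin n → Ω → ℝ) (hmeas : ∀ i, Measurable (X i))
    (hgauss : ∀ c : Fin n → ℝ, ∃ (m : ℝ) (v : NNReal),
      Measure.map (fun ω => ∑ i, c i * X i ω) P = gaussianReal m v) :
    (∀ i j, 0 ≤ (∫ ω, X i ω * X j ω ∂P) - (∫ ω, X i ω ∂P) * (∫ ω, X j ω ∂P)) ↔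
    (∀ f g : (Fin n → ℝ) → ℝ, Measurable f → Measurable g →
      (∃ Cf : ℝ, ∀ x, |f x| ≤ Cf) → (∃ Cg : ℝ, ∀ x, |g x| ≤ Cg) →
      (∀ x y : Fin n → ℝ, (∀ i, x i ≤ y i) → f x ≤ f y) →
      (∀ x y : Fin n → ℝ, (∀ i, x i ≤ y i) → g x ≤ g y) →
      0 ≤ (∫ ω, f (fun i => X i ω) * g (fun i => X i ω) ∂P)
          - (∫ ω, f (fun i => X i ω) ∂P) * (∫ ω, g (fun i => X i ω) ∂P)) := by
  have hG := isGaussian_map_of_forall_sum hmeas hgauss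
  have hXm : Measurable fun ω i => X i ω := measurable_pi_lambda _ hmeas
  have hL2 (i) : MemLp (X i) 2 P :=
    (memLp_map_measure_iff (measurable_pi_apply i).aestronglyMeasurable hXm.aemeasurable).1
      (memLp_coord (P.map fun ω i => X i ω) i)
  constructor
  · intro hcov f g hf hg ⟨C, hC⟩ ⟨D, hD⟩ hfm hgm
    let m : Fin n → ℝ := fun i => ∫ ω, X i ω ∂P
    let μ : Measure (Fin n → ℝ) := (P.map fun ω i => X i ω).map fun x => x - m
    have hμ {h : (Fin n → ℝ) → ℝ} (hh : Measurable h) :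
        ∫ x, h x ∂μ = ∫ ω, h ((fun i => X i ω) - m) ∂P := by
      refine (integral_map (by fun_prop) hh.aestronglyMeasurable).trans ?_
      exact integral_map hXm.aemeasurable
          (hh.comp (measurable_sub_const m)).aestronglyMeasurable
    have hf' := hf.comp (measurable_add_const m)
    have hg' := hg.comp (measurable_add_const m)
    have hassoc := integral_mul_le_of_monotone (μ := μ) (fun i => by
        rw [hμ (measurable_pi_apply i)]
        simp only [Pi.sub_apply]
        rw [integral_sub ((hL2 i).integrable one_le_two) (integrable_const _)]
        simp [m]) (fun i j => by
        rw [hμ (h := fun x => x i * x j) (by fun_prop)]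
        exact (hcov i j).trans_eq (covariance_eq_sub (hL2 i) (hL2 j)).symm)
      hf' (fun x => hC _) (fun x y hxy => hfm _ _ (add_le_add_left hxy m))
      hg' (fun x => hD _) (fun x y hxy => hgm _ _ (add_le_add_left hxy m))
    rw [hμ hf', hμ hg', hμ (hf'.fun_mul hg')] at hassoc
    simpa only [Function.comp_apply, sub_add_cancel, sub_nonneg] using hassoc
  · intro H i j
    have hb (k : ℕ) (x : ℝ) : |max (-(k : ℝ)) (min k x)| ≤ k :=
      abs_le.2 ⟨le_max_left _ _,
        max_le (neg_le_self k.cast_nonneg) (min_le_left _ _)⟩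
    refine covariance_nonneg_of_truncation (hL2 i) (hL2 j) fun k => ?_
    exact H (fun x => max (-k) (min k (x i))) (fun x => max (-k) (min k (x j)))
      (by fun_prop) (by fun_prop) ⟨k, fun x => hb k _⟩ ⟨k, fun x => hb k _⟩
      (fun x y h => max_le_max le_rfl (min_le_min le_rfl (h i)))
      (fun x y h => max_le_max le_rfl (min_le_min le_rfl (h j)))
end
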